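/- Let (X,Σ,μ) be a standard (Lebesgue) probability space and T an invertible measure-preserving transformation of X such that T^n is ergodic for every n ≥ 1 (completely ergodic). Let g:[0,1]→ℝ be concave with g(0) = lim_{x→0⁺} g(x) = 0 and 0 < lim_{x→0⁺} g(x)/η(x) < ∞, where η(x) = −x log₂ x. Let φ:[0,∞) → (0,∞) be an increasing function with ∫₁^∞ φ(x)/x² dx < ∞. Then for every binary partition P = {E, X∖E} with 0 < μ(E) < 1, limsup_{n→∞} H(g, P_n)/φ(log₂ n) = ∞. -/

import Mathlib

open MeasureTheory Filter Set

/-- The atom of the join partition `P ∨ T⁻¹P ∨ ⋯ ∨ T^{-(n-1)}P` of the binary partition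
`{E, Eᶜ}` corresponding to the 01-name `s`. -/
def cyl {X : Type*} (T : X → X) (E : Set X) (n : ℕ) (s : Fin n → Bool) : Set X :=
  {x | ∀ i : Fin n, (T^[(i : ℕ)] x ∈ E ↔ s i = true)}

/-- The `g`-entropy `H(g, P_n)` of the join partition `P_n` of the binary partition
`P = {E, Eᶜ}`. -/
noncomputable def binEnt {X : Type*} [MeasurableSpace X] (μ : Measure X)
    (T : X → X) (g : ℝ → ℝ) (E : Set X) (n : ℕ) : ℝ :=
  ∑ s : Fin n → Bool, g ((μ (cyl T E n s)).toReal)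

/-- The Shannon function `η(x) = −x·log₂ x`. -/
noncomputable def shannonF : ℝ → ℝ := fun x => -(x * Real.logb 2 x)

/-- The atoms of the join partition are measurable. -/
lemma measurableSet_cyl {X : Type*} [MeasurableSpace X] {T : X → X} (hT : Measurable T)
    {E : Set X} (hE : MeasurableSet E) (n : ℕ) (s : Fin n → Bool) :
    MeasurableSet (cyl T E n s) := by
  have : cyl T E n s = ⋂ i : Fin n, {x | T^[(i : ℕ)] x ∈ E ↔ s i = true} := by
    ext x; simp [cyl]
  rw [this]
  refine MeasurableSet.iInter fun i => ?_
  have hm : MeasurableSet {x | T^[(i : ℕ)] x ∈ E} := (hT.iterate i) hE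
  exact hm.iff (MeasurableSet.const _)

/-- Distinct names label disjoint atoms. -/
lemma eq_of_mem_cyl {X : Type*} {T : X → X} {E : Set X} {n : ℕ} {s t : Fin n → Bool} {x : X}
    (hs : x ∈ cyl T E n s) (ht : x ∈ cyl T E n t) : s = t := by
  funext i
  exact Bool.eq_iff_iff.2 ((hs i).symm.trans (ht i))

lemma sum_measureReal_cyl_le_one {X : Type*} [MeasurableSpace X] (μ : Measure X)
    [IsProbabilityMeasure μ] {T : X → X} (hT : Measurable T) {E : Set X} (hE : MeasurableSet E)
    {n : ℕ} (F : Finset (Fin n → Bool)) :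
    ∑ s ∈ F, (μ (cyl T E n s)).toReal ≤ 1 := by
  have h : ∑ s ∈ F, μ (cyl T E n s) ≤ μ univ := by
    refine sum_measure_le_measure_univ
      (fun s _ => (measurableSet_cyl hT hE n s).nullMeasurableSet) ?_
    intro s _ t _ hst
    refine Disjoint.aedisjoint (Set.disjoint_left.2 fun x hs ht => hst (eq_of_mem_cyl hs ht))
  rw [← ENNReal.toReal_sum (fun s _ => measure_ne_top μ _)]
  calc _ ≤ (μ univ).toReal := ENNReal.toReal_mono (measure_ne_top _ _) h
    _ = 1 := by simp

/-- The points whose atom in the `n`-th join partition has measure at most `t`. -/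
def smallAtoms {X : Type*} [MeasurableSpace X] (μ : Measure X) (T : X → X) (E : Set X)
    (n : ℕ) (t : ℝ) : Set X :=
  ⋃ s ∈ Finset.univ.filter (fun s : Fin n → Bool => (μ (cyl T E n s)).toReal ≤ t), cyl T E n s

/-- A lower bound for the entropy in terms of the total measure of the small atoms. -/
lemma mul_measureReal_smallAtoms_le {X : Type*} [MeasurableSpace X] (μ : Measure X)
    [IsProbabilityMeasure μ] {T : X → X} (hT : Measurable T) {E : Set X} (hE : MeasurableSet E)
    {g : ℝ → ℝ} {a b t : ℝ} (ha : 0 ≤ a) (hb : 0 ≤ b)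
    (hsmall : ∀ x, 0 ≤ x → x ≤ t → a * x ≤ g x)
    (hlow : ∀ x, 0 ≤ x → x ≤ 1 → -(b * x) ≤ g x) (n : ℕ) :
    a * (μ (smallAtoms μ T E n t)).toReal ≤ binEnt μ T g E n + b := by
  classical
  set p : (Fin n → Bool) → Prop := fun s => (μ (cyl T E n s)).toReal ≤ t with hp
  have h1 : (μ (smallAtoms μ T E n t)).toReal ≤
      ∑ s ∈ Finset.univ.filter p, (μ (cyl T E n s)).toReal := by
    rw [← ENNReal.toReal_sum (fun s _ => measure_ne_top μ _)]
    refine ENNReal.toReal_mono (ENNReal.sum_ne_top.2 fun s _ => measure_ne_top μ _) ?_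
    unfold smallAtoms
    refine (measure_biUnion_finset_le _ _).trans (le_of_eq ?_)
    exact Finset.sum_congr (by ext s; simp [hp]) fun _ _ => rfl
  have h2 : a * ∑ s ∈ Finset.univ.filter p, (μ (cyl T E n s)).toReal ≤
      ∑ s ∈ Finset.univ.filter p, g (μ (cyl T E n s)).toReal := by
    rw [Finset.mul_sum]
    exact Finset.sum_le_sum fun s hs =>
      hsmall _ ENNReal.toReal_nonneg (Finset.mem_filter.1 hs).2
  have h3 : -(b * ∑ s ∈ Finset.univ.filter (fun s => ¬ p s), (μ (cyl T E n s)).toReal) ≤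
      ∑ s ∈ Finset.univ.filter (fun s => ¬ p s), g (μ (cyl T E n s)).toReal := by
    rw [Finset.mul_sum, ← Finset.sum_neg_distrib]
    exact Finset.sum_le_sum fun s _ => hlow _ ENNReal.toReal_nonneg
      (ENNReal.toReal_mono ENNReal.one_ne_top prob_le_one)
  have h4 := sum_measureReal_cyl_le_one μ hT hE (Finset.univ.filter (fun s => ¬ p s))
  have h5 : binEnt μ T g E n = _ :=
    (Finset.sum_filter_add_sum_filter_not Finset.univ p
      (fun s => g (μ (cyl T E n s)).toReal)).symm
  have h6 := mul_le_mul_of_nonneg_left h1 ha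
  have h7 := mul_le_mul_of_nonneg_left h4 hb
  linarith

/-- If the atom of `x` is not small then the name of `x` has a short period. -/
lemma exists_period_of_notMem_smallAtoms {X : Type*} [MeasurableSpace X] (μ : Measure X)
    [IsProbabilityMeasure μ] {T : X → X} (hT : MeasurePreserving T μ μ) {E : Set X}
    (hE : MeasurableSet E) {n K : ℕ} (hK : 0 < K) {x : X}
    (hx : x ∉ smallAtoms μ T E n (1 / K)) :
    ∃ k, 0 < k ∧ k < K ∧ ∀ i, i + k < n → (T^[i] x ∈ E ↔ T^[i + k] x ∈ E) := by
  classical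
  set s : Fin n → Bool := fun i => decide (T^[(i : ℕ)] x ∈ E) with hs
  have hxs : x ∈ cyl T E n s := fun i => by simp [hs]
  have hbig : (1 : ℝ) / K < (μ (cyl T E n s)).toReal := by
    by_contra! h
    exact hx (Set.mem_biUnion (by simpa using h) hxs)
  have hvol : μ univ < K * μ (cyl T E n s) := by
    rw [measure_univ]
    rw [← ENNReal.toReal_lt_toReal ENNReal.one_ne_top
      (ENNReal.mul_ne_top (ENNReal.natCast_ne_top K) (measure_ne_top _ _))]
    rw [ENNReal.toReal_mul, ENNReal.toReal_natCast, ENNReal.toReal_one]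
    have : (0 : ℝ) < K := by exact_mod_cast hK
    rwa [div_lt_iff₀' this] at hbig
  obtain ⟨y, hy, k, hk, hky⟩ := hT.exists_mem_iterate_mem_of_measure_univ_lt_mul_measure
    (measurableSet_cyl hT.measurable hE n s).nullMeasurableSet hvol
  refine ⟨k, hk.1, hk.2, fun i hi => ?_⟩
  have e1 := hy ⟨i + k, hi⟩
  have e2 := hky ⟨i, by omega⟩
  have e3 := hxs ⟨i + k, hi⟩
  have e4 := hxs ⟨i, by omega⟩
  simp only [← Function.iterate_add_apply] at e1 e2 e3 e4
  tauto

/-- A period of a prefix extends to a longer word having a period that is short compared with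
the prefix. -/
lemma period_extend {u : ℕ → Prop} {m n k l : ℕ} (hl : 0 < l) (hkl : k + l ≤ m)
    (hm : ∀ i, i + k < m → (u i ↔ u (i + k))) (hn : ∀ i, i + l < n → (u i ↔ u (i + l))) :
    ∀ i, i + k < n → (u i ↔ u (i + k)) := by
  intro i
  induction i using Nat.strong_induction_on with
  | _ i ih =>
    intro hi
    rcases lt_or_ge i l with h | h
    · exact hm i (by omega)
    · obtain ⟨r, rfl⟩ := Nat.exists_eq_add_of_le' h
      by_cases hr : r + l < n
      · have h1 := hn r hr
        have h2 := hn (r + k) (by omega)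
        have h3 := ih r (by omega) (by omega)
        rw [show r + l + k = r + k + l by omega]
        tauto
      · omega

/-- Short periods at all sufficiently large scales `2 ^ (4 * 2 ^ j)` force genuine
periodicity. -/
lemma exists_period_of_eventually {u : ℕ → Prop}
    (h : ∀ᶠ j : ℕ in atTop, ∃ k, 0 < k ∧ k < 2 ^ 2 ^ j ∧
      ∀ i, i + k < 2 ^ (4 * 2 ^ j) → (u i ↔ u (i + k))) :
    ∃ k, 0 < k ∧ ∀ i, u i ↔ u (i + k) := by
  obtain ⟨J, hJ⟩ := eventually_atTop.1 h
  obtain ⟨k, hk0, hkJ, hk⟩ := hJ J le_rfl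
  have key : ∀ j, J ≤ j → ∀ i, i + k < 2 ^ (4 * 2 ^ j) → (u i ↔ u (i + k)) := by
    intro j hj
    induction j, hj using Nat.le_induction with
    | base => exact hk
    | succ j hj ih =>
      obtain ⟨l, hl0, hlj, hl⟩ := hJ (j + 1) (by omega)
      refine period_extend hl0 ?_ ih hl
      have hKm : (2 : ℕ) ^ 2 ^ J ≤ 2 ^ 2 ^ j :=
        Nat.pow_le_pow_right two_pos (Nat.pow_le_pow_right two_pos hj)
      have hq : 2 ≤ (2 : ℕ) ^ 2 ^ j :=
        (Nat.pow_le_pow_right two_pos Nat.one_le_two_pow : 2 ^ 1 ≤ _)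
      rw [pow_succ 2 j, pow_mul] at hlj
      rw [mul_comm, pow_mul]
      generalize 2 ^ 2 ^ j = q at *
      nlinarith [Nat.mul_le_mul hq hq, Nat.mul_le_mul_right (q ^ 2) (Nat.mul_le_mul hq hq)]
  refine ⟨k, hk0, fun i => ?_⟩
  refine key (J + (i + k)) (by omega) i ?_
  have h1 : i + k < 2 ^ (i + k) := Nat.lt_two_pow_self
  have h2 : J + (i + k) < 2 ^ (J + (i + k)) := Nat.lt_two_pow_self
  exact h1.trans_le (Nat.pow_le_pow_right two_pos (by omega))

/-- Under complete ergodicity, a set is trivial if almost every name is periodic. -/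
lemma measure_eq_zero_or_one_of_ae_periodic {X : Type*} [MeasurableSpace X] (μ : Measure X)
    [IsProbabilityMeasure μ] {T : X → X} (herg : ∀ n : ℕ, 1 ≤ n → Ergodic (T^[n]) μ)
    {E : Set X} (hE : MeasurableSet E)
    (h : ∀ᵐ x ∂μ, ∃ k, 0 < k ∧ ∀ i, T^[i] x ∈ E ↔ T^[i + k] x ∈ E) :
    μ E = 0 ∨ μ E = 1 := by
  have hT : Ergodic T μ := by simpa using herg 1 le_rfl
  let F : ℕ → Set X := fun k => {x | ∀ i, T^[i] x ∈ E ↔ T^[i + k] x ∈ E}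
  have hF : ∀ k, MeasurableSet (F k) := by
    intro k
    have : F k = ⋂ i, {x | T^[i] x ∈ E ↔ T^[i + k] x ∈ E} := by ext x; simp [F]
    rw [this]
    refine MeasurableSet.iInter fun i => ?_
    have h1 : MeasurableSet {x | T^[i] x ∈ E} := (hT.measurable.iterate i) hE
    have h2 : MeasurableSet {x | T^[i + k] x ∈ E} := (hT.measurable.iterate (i + k)) hE
    exact h1.iff h2
  obtain ⟨k, hk0, hk⟩ : ∃ k, 0 < k ∧ μ (F k) ≠ 0 := by
    by_contra! hcon
    have h0 : ∀ᵐ x ∂μ, ∀ k, 0 < k → x ∉ F k := by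
      rw [ae_all_iff]
      intro k
      by_cases hk : 0 < k
      · filter_upwards [measure_eq_zero_iff_ae_notMem.1 (hcon k hk)] with x hx _ using hx
      · exact ae_of_all _ fun x hx => absurd hx hk
    have : ∀ᵐ x ∂μ, False := by
      filter_upwards [h, h0] with x ⟨k, hk, hx⟩ hx0 using hx0 k hk hx
    exact IsProbabilityMeasure.ne_zero μ (by simpa using this)
  have hsub : F k ⊆ T ⁻¹' F k := by
    intro x hx i
    have := hx (i + 1)
    rw [show i + 1 + k = i + k + 1 by omega] at this
    simpa only [Function.iterate_succ_apply] using this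
  have hfull : ∀ᵐ x ∂μ, x ∈ F k := by
    rcases hT.ae_empty_or_univ_of_ae_le_preimage (hF k).nullMeasurableSet
      hsub.eventuallyLE with h1 | h1
    · exact absurd (ae_eq_empty.1 h1) hk
    · exact eventuallyEq_univ.1 h1
  have hinv : (T^[k]) ⁻¹' E =ᵐ[μ] E := by
    filter_upwards [hfull] with x hx
    have := hx 0
    simp only [zero_add, Function.iterate_zero, id] at this
    exact propext this.symm
  rcases (herg k hk0).quasiErgodic.ae_empty_or_univ₀ hE.nullMeasurableSet hinv with h1 | h1
  · exact Or.inl (ae_eq_empty.1 h1)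
  · exact Or.inr (by rw [measure_congr h1, measure_univ])

/-- The dyadic form of the integrability condition on `φ`. -/
lemma summable_dyadic {φ : ℝ → ℝ} (hφpos : ∀ x : ℝ, 0 ≤ x → 0 < φ x)
    (hφmono : MonotoneOn φ (Set.Ici 0))
    (hφint : IntegrableOn (fun x => φ x / x ^ 2) (Set.Ioi 1)) :
    Summable fun j : ℕ => φ (2 ^ j) / 2 ^ j := by
  let I : ℕ → Set ℝ := fun j => Set.Ioc (2 ^ j) (2 ^ (j + 1))
  have hmono : Monotone fun j : ℕ => (2 : ℝ) ^ j := pow_right_mono₀ one_le_two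
  have hdisj : Pairwise (Function.onFun Disjoint I) := by
    have := hmono.pairwise_disjoint_on_Ioc_succ
    simpa [I] using this
  have hsub : (⋃ j, I j) ⊆ Set.Ioi 1 := by
    refine Set.iUnion_subset fun j x hx => ?_
    exact lt_of_le_of_lt (one_le_pow₀ one_le_two) hx.1
  have hsum := (hasSum_integral_iUnion (fun j => measurableSet_Ioc) hdisj
    (hφint.mono_set hsub)).summable
  refine Summable.of_nonneg_of_le (fun j => ?_) (fun j => ?_) (hsum.mul_left 4)
  · exact div_nonneg (hφpos _ (by positivity)).le (by positivity)
  · have hle : ∫ x in I j, φ (2 ^ j) / (2 ^ (j + 1)) ^ 2 ≤ ∫ x in I j, φ x / x ^ 2 := by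
      refine setIntegral_mono_on (by simp [I]) ?_ measurableSet_Ioc ?_
      · exact hφint.mono_set ((Set.subset_iUnion I j).trans hsub)
      · intro x hx
        have hx0 : (0 : ℝ) < x := lt_trans (by positivity) hx.1
        have h1 : φ (2 ^ j) ≤ φ x := hφmono (Set.mem_Ici.2 (by positivity))
          (Set.mem_Ici.2 hx0.le) hx.1.le
        have h2 : x ^ 2 ≤ (2 ^ (j + 1)) ^ 2 := pow_le_pow_left₀ hx0.le hx.2 2
        exact div_le_div₀ (hφpos x hx0.le).le h1 (by positivity) h2
    have hconst : ∫ x in I j, φ (2 ^ j) / (2 ^ (j + 1)) ^ 2 = φ (2 ^ j) / 2 ^ j / 4 := by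
      have hp : (0 : ℝ) < 2 ^ j := by positivity
      have hv : (volume.real (I j)) = 2 ^ j := by
        simp only [I, Real.volume_real_Ioc, pow_succ]
        rw [max_eq_left] <;> linarith
      rw [setIntegral_const, hv, smul_eq_mul, pow_succ (2 : ℝ) j]
      field_simp
      norm_num
    rw [hconst] at hle
    linarith

/-- An entropy function of class `G₀^sh` dominates a multiple of the Shannon function near
zero. -/
lemma exists_mul_shannonF_le {g : ℝ → ℝ}
    (hsh : ∃ L : ℝ, 0 < L ∧
      Tendsto (fun x => g x / shannonF x) (nhdsWithin 0 (Set.Ioi 0)) (nhds L)) :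
    ∃ c > 0, ∃ δ > 0, ∀ x, 0 < x → x < δ → c * shannonF x ≤ g x := by
  obtain ⟨L, hL, hlim⟩ := hsh
  have h := hlim.eventually (lt_mem_nhds (half_lt_self hL))
  obtain ⟨δ, hδ, hδ'⟩ := (mem_nhdsGT_iff_exists_Ioo_subset).1 h
  refine ⟨L / 2, half_pos hL, min δ 1, lt_min hδ one_pos, fun x hx hxδ => ?_⟩
  have h1 : L / 2 < g x / shannonF x := hδ' ⟨hx, hxδ.trans_le (min_le_left _ _)⟩
  have h2 : 0 < shannonF x := by
    have := Real.logb_neg one_lt_two hx (hxδ.trans_le (min_le_right _ _))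
    unfold shannonF
    nlinarith
  exact ((lt_div_iff₀ h2).1 h1).le

/-- For a completely ergodic invertible measure-preserving transformation of a standard
probability space, an entropy function `g ∈ G₀^sh`, and an increasing `φ : [0,∞) → (0,∞)`
with `∫₁^∞ φ(x)/x² dx < ∞`, every nontrivial binary partition satisfies
`limsup H(g, Pₙ)/φ(log₂ n) = ∞`. -/
theorem statement5 {X : Type*} [MeasurableSpace X] [StandardBorelSpace X]
    (μ : Measure X) [IsProbabilityMeasure μ] (T : X → X)
    (hT : MeasurePreserving T μ μ)
    (hinv : ∃ S : X → X, Measurable S ∧ Function.LeftInverse S T ∧ Function.RightInverse S T)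
    (herg : ∀ n : ℕ, 1 ≤ n → Ergodic (T^[n]) μ)
    (g : ℝ → ℝ) (hconc : ConcaveOn ℝ (Set.Icc 0 1) g) (hg0 : g 0 = 0)
    (hg0' : Tendsto g (nhdsWithin 0 (Set.Ioi 0)) (nhds 0))
    (hsh : ∃ L : ℝ, 0 < L ∧
      Tendsto (fun x => g x / shannonF x) (nhdsWithin 0 (Set.Ioi 0)) (nhds L))
    (φ : ℝ → ℝ)
    (hφpos : ∀ x : ℝ, 0 ≤ x → 0 < φ x)
    (hφmono : MonotoneOn φ (Set.Ici 0))
    (hφint : IntegrableOn (fun x => φ x / x ^ 2) (Set.Ioi 1))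
    (E : Set X) (hE : MeasurableSet E) (h0 : 0 < μ E) (h1 : μ E < 1) :
    Filter.limsup
      (fun n : ℕ => ((binEnt μ T g E n / φ (Real.logb 2 n) : ℝ) : EReal)) atTop = ⊤ := by
  by_contra hlim
  obtain ⟨M, hM⟩ : ∃ M : ℝ, ∀ᶠ n : ℕ in atTop,
      binEnt μ T g E n / φ (Real.logb 2 n) < M := by
    obtain ⟨M, hM, -⟩ := EReal.lt_iff_exists_real_btwn.1 (lt_top_iff_ne_top.2 hlim)
    refine ⟨M, ?_⟩
    filter_upwards [eventually_lt_of_limsup_lt hM] with n hn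
    exact_mod_cast hn
  obtain ⟨c, hc, δ, hδ, hcδ⟩ := exists_mul_shannonF_le hsh
  have hlow : ∀ x, 0 ≤ x → x ≤ 1 → -(|g 1| * x) ≤ g x := by
    intro x hx0 hx1
    have h := hconc.2 (left_mem_Icc.2 zero_le_one) (right_mem_Icc.2 zero_le_one)
      (sub_nonneg.2 hx1) hx0 (by ring)
    simp only [smul_eq_mul, hg0, mul_zero, zero_add, mul_one] at h
    nlinarith [neg_abs_le (g 1)]
  let B : ℕ → Set X := fun j => smallAtoms μ T E (2 ^ (4 * 2 ^ j)) (1 / (2 ^ 2 ^ j : ℕ))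
  have hscale : Tendsto (fun j : ℕ => (2 : ℕ) ^ (4 * 2 ^ j)) atTop atTop := by
    refine tendsto_atTop_mono (fun j => ?_) tendsto_id
    have h1 : j < 2 ^ j := Nat.lt_two_pow_self
    have h2 : 4 * 2 ^ j < 2 ^ (4 * 2 ^ j) := Nat.lt_two_pow_self
    simp only [id]
    omega
  have hthr : ∀ᶠ j : ℕ in atTop, (1 : ℝ) / (2 ^ 2 ^ j : ℕ) < δ := by
    have h1 : Tendsto (fun j : ℕ => (2 : ℕ) ^ 2 ^ j) atTop atTop := by
      refine tendsto_atTop_mono (fun j => ?_) tendsto_id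
      exact (Nat.lt_two_pow_self.trans Nat.lt_two_pow_self).le
    exact (tendsto_one_div_atTop_nhds_zero_nat.comp h1).eventually (gt_mem_nhds hδ)
  have hbound : ∀ᶠ j : ℕ in atTop, (μ (B j)).toReal ≤
      4 * M / c * (φ (2 ^ (j + 2)) / 2 ^ (j + 2)) + |g 1| / c * (1 / 2) ^ j := by
    filter_upwards [hthr, hscale.eventually hM] with j hj hMj
    have hp : (0 : ℝ) < 2 ^ j := by positivity
    have hsmall : ∀ x, 0 ≤ x → x ≤ 1 / ((2 ^ 2 ^ j : ℕ) : ℝ) → c * 2 ^ j * x ≤ g x := by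
      intro x hx0 hx
      rcases hx0.eq_or_lt with rfl | hx0
      · simp [hg0]
      refine le_trans ?_ (hcδ x hx0 (hx.trans_lt hj))
      have hlog : Real.logb 2 x ≤ -(2 ^ j : ℝ) := by
        rw [Real.logb_le_iff_le_rpow one_lt_two hx0, Real.rpow_neg two_pos.le]
        have : (2 : ℝ) ^ (2 ^ j : ℝ) = (2 ^ 2 ^ j : ℕ) := by
          rw [show (2 ^ j : ℝ) = ((2 ^ j : ℕ) : ℝ) by push_cast; rfl, Real.rpow_natCast]
          push_cast
          rfl
        rw [this, ← one_div]
        exact hx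
      unfold shannonF
      rw [mul_assoc]
      refine mul_le_mul_of_nonneg_left ?_ hc.le
      nlinarith
    have h := mul_measureReal_smallAtoms_le μ hT.measurable hE (by positivity)
      (abs_nonneg (g 1)) hsmall hlow (2 ^ (4 * 2 ^ j))
    have hlogn : Real.logb 2 ((2 ^ (4 * 2 ^ j) : ℕ) : ℝ) = 2 ^ (j + 2) := by
      rw [Nat.cast_pow, Real.logb_pow, Nat.cast_ofNat, Real.logb_self_eq_one one_lt_two]
      push_cast
      ring
    rw [hlogn, div_lt_iff₀ (hφpos _ (by positivity))] at hMj
    have h' : c * 2 ^ j * (μ (B j)).toReal ≤ M * φ (2 ^ (j + 2)) + |g 1| := by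
      linarith
    have heq : 4 * M / c * (φ (2 ^ (j + 2)) / 2 ^ (j + 2)) + |g 1| / c * (1 / 2) ^ j =
        (M * φ (2 ^ (j + 2)) + |g 1|) / (c * 2 ^ j) := by
      rw [one_div, inv_pow, pow_add 2 j 2]
      generalize φ _ = y
      field_simp
      ring
    rw [heq, le_div_iff₀ (by positivity)]
    linarith
  have hsum : Summable fun j => (μ (B j)).toReal := by
    have h1 := (summable_nat_add_iff 2).2 (summable_dyadic hφpos hφmono hφint)
    refine Summable.of_norm_bounded_eventually_nat ((h1.mul_left (4 * M / c)).add
      ((summable_geometric_two).mul_left (|g 1| / c))) ?_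
    filter_upwards [hbound] with j hj
    rwa [Real.norm_of_nonneg ENNReal.toReal_nonneg]
  have hfin : ∑' j, μ (B j) ≠ ⊤ := by
    have h1 := hsum.tsum_ofReal_ne_top
    simpa only [ENNReal.ofReal_toReal (measure_ne_top μ _)] using h1
  have hper : ∀ᵐ x ∂μ, ∃ k, 0 < k ∧ ∀ i, T^[i] x ∈ E ↔ T^[i + k] x ∈ E := by
    filter_upwards [ae_eventually_notMem hfin] with x hx
    refine exists_period_of_eventually (u := fun i => T^[i] x ∈ E) ?_
    filter_upwards [hx] with j hj
    exact exists_period_of_notMem_smallAtoms μ hT hE (by positivity) hj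
  rcases measure_eq_zero_or_one_of_ae_periodic μ herg hE hper with h | h
  · exact h0.ne' h
  · exact h1.ne h
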